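/- There exists a linear ordinal margin matrix with exactly 7 alternatives in which the SSV winner is not a Split Cycle winner. -/

import Mathlib

variable {X : Type} [DecidableEq X]

/-- `(V, succ)` is an ordinal margin matrix: `V` is a nonempty (finite) set of alternatives
and `succ` (the relation `≻`) is asymmetric, negatively transitive, and ordinally
skew-symmetric on `V × V`. -/
def IsOMM (V : Finset X) (succ : X × X → X × X → Prop) : Prop :=
  V.Nonempty ∧
  (∀ p q : X × X, p.1 ∈ V → p.2 ∈ V → q.1 ∈ V → q.2 ∈ V → succ p q → ¬ succ q p) ∧
  (∀ p q r : X × X, p.1 ∈ V → p.2 ∈ V → q.1 ∈ V → q.2 ∈ V → r.1 ∈ V → r.2 ∈ V →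
      ¬ succ p q → ¬ succ q r → ¬ succ p r) ∧
  (∀ a b c d : X, a ∈ V → b ∈ V → c ∈ V → d ∈ V →
      (succ (a, b) (c, d) ↔ succ (d, c) (b, a)))

/-- A linear ordinal margin matrix: additionally `≻` is connected on pairs of
distinct alternatives, hence a strict linear order there. -/
def IsLinearOMM (V : Finset X) (succ : X × X → X × X → Prop) : Prop :=
  IsOMM V succ ∧
  ∀ a b c d : X, a ∈ V → b ∈ V → c ∈ V → d ∈ V → a ≠ b → c ≠ d → (a, b) ≠ (c, d) →
    (succ (a, b) (c, d) ∨ succ (c, d) (a, b))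

/-- `a` defeats `b` according to Split Cycle in `(V, succ)`: `(a,b) ≻ (b,a)` and there is no
cycle in the majority graph (a duplicate-free list `l` of vertices of `V` whose consecutive
steps, including the wrap-around step — i.e. all the pairs of `l.zip (l.rotate 1)` — are
majority edges) such that `(a,b)` is an edge of the cycle that is weakest in the cycle,
i.e. `(a,b)` is not `≻`-stronger than any edge of the cycle. -/
def SCdefeats (V : Finset X) (succ : X × X → X × X → Prop) (a b : X) : Prop :=
  a ∈ V ∧ b ∈ V ∧ succ (a, b) (b, a) ∧
    ¬ ∃ l : List X, l.Nodup ∧ (∀ x ∈ l, x ∈ V) ∧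
        (∀ e ∈ l.zip (l.rotate 1), succ (e.1, e.2) (e.2, e.1)) ∧
        (a, b) ∈ l.zip (l.rotate 1) ∧
        (∀ e ∈ l.zip (l.rotate 1), ¬ succ (a, b) (e.1, e.2))

/-- `a` is a Split Cycle winner in `(V, succ)`: `a` is not defeated by any alternative. -/
def SCwinner (V : Finset X) (succ : X × X → X × X → Prop) (a : X) : Prop :=
  a ∈ V ∧ ∀ b ∈ V, ¬ SCdefeats V succ b a

/-- Auxiliary definition of Simple Stable Voting winners, by recursion on a fuel parameter
that is always instantiated to the cardinality of the set of alternatives (deleting a member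
of `V` decreases the cardinality by exactly one, so the fuel always matches). -/
def SSVwinAux (succ : X × X → X × X → Prop) : ℕ → Finset X → X → Prop
  | 0, _, _ => False
  | n + 1, V, a =>
      V = {a} ∨
        (1 < V.card ∧ ∃ b ∈ V, a ∈ V.erase b ∧ SSVwinAux succ n (V.erase b) a ∧
          ∀ c d : X, d ∈ V → c ∈ V.erase d → (c, d) ≠ (a, b) →
            SSVwinAux succ n (V.erase d) c → succ (a, b) (c, d))

/-- `a` is a Simple Stable Voting (SSV) winner in `(V, succ)`: either `V = {a}`, or there is
`b` such that `a` is the SSV winner of `V` with `b` deleted and `(a,b)` is the `≻`-maximal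
pair `(c,d)` of distinct alternatives such that `c` is the SSV winner of `V` with `d`
deleted (i.e. `(a,b)` is `≻`-stronger than every other such pair). -/
def SSVwin (V : Finset X) (succ : X × X → X × X → Prop) (a : X) : Prop :=
  SSVwinAux succ V.card V a

/-- Auxiliary definition of Stable Voting winners (fuel-indexed as in `SSVwinAux`). -/
def SVwinAux (succ : X × X → X × X → Prop) : ℕ → Finset X → X → Prop
  | 0, _, _ => False
  | n + 1, V, a =>
      V = {a} ∨
        (1 < V.card ∧ ∃ b ∈ V, a ∈ V.erase b ∧ SCwinner V succ a ∧
          SVwinAux succ n (V.erase b) a ∧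
          ∀ c d : X, d ∈ V → c ∈ V.erase d → (c, d) ≠ (a, b) →
            SCwinner V succ c → SVwinAux succ n (V.erase d) c → succ (a, b) (c, d))

/-- `a` is a Stable Voting (SV) winner in `(V, succ)`: like SSV, but the witnessing pairs
`(c,d)` must additionally have `c` a Split Cycle winner of `(V, succ)`. -/
def SVwin (V : Finset X) (succ : X × X → X × X → Prop) (a : X) : Prop :=
  SVwinAux succ V.card V a

/-- Auxiliary definition of SSV-SE winners (fuel-indexed as in `SSVwinAux`). -/
def SSVSEwinAux (succ : X × X → X × X → Prop) : ℕ → Finset X → X → Prop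
  | 0, _, _ => False
  | n + 1, V, a =>
      V = {a} ∨
        (1 < V.card ∧ ∃ b ∈ V, a ∈ V.erase b ∧ SSVSEwinAux succ n (V.erase b) a ∧
          ∀ c d : X, d ∈ V → c ∈ V.erase d → SSVSEwinAux succ n (V.erase d) c →
            ¬ succ (c, d) (a, b))

/-- `a` is a Simple Stable Voting with Simultaneous Elimination (SSV-SE) winner in
`(V, succ)`: either `V = {a}`, or `a` is the first coordinate of a `≻`-maximal element
`(a,b)` of the set of pairs `(c,d)` of distinct alternatives such that `c` is an SSV-SE
winner of `V` with `d` deleted (maximal: no such pair is `≻`-stronger than `(a,b)`). -/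
def SSVSEwin (V : Finset X) (succ : X × X → X × X → Prop) (a : X) : Prop :=
  SSVSEwinAux succ V.card V a

/-- `succ'` is a linearization of `succ` on `V`: `succ'` is a linear ordinal margin matrix
relation on `V` extending `succ` on `V`. -/
def IsLinearization (V : Finset X) (succ succ' : X × X → X × X → Prop) : Prop :=
  IsLinearOMM V succ' ∧
  ∀ p q : X × X, p.1 ∈ V → p.2 ∈ V → q.1 ∈ V → q.2 ∈ V → succ p q → succ' p q

/-- `a` is an SSV-PUT (parallel-universe tiebreaking) winner in `(V, succ)`:
`a` is the SSV winner of some linearization of `(V, succ)`. -/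
def SSVPUTwin (V : Finset X) (succ : X × X → X × X → Prop) (a : X) : Prop :=
  ∃ succ' : X × X → X × X → Prop, IsLinearization V succ succ' ∧ SSVwin V succ' a

/-- `r` is a strict linear order on (the elements of) `V`. -/
def IsLinOrderOn (V : Finset X) (r : X → X → Prop) : Prop :=
  (∀ a ∈ V, ¬ r a a) ∧
  (∀ a ∈ V, ∀ b ∈ V, ∀ c ∈ V, r a b → r b c → r a c) ∧
  (∀ a ∈ V, ∀ b ∈ V, a ≠ b → (r a b ∨ r b a))

open Classical in
/-- The margin of `a` vs. `b` in the profile `P` with voters `Fin m`: the number of voters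
ranking `a` above `b` minus the number of voters ranking `b` above `a`. -/
noncomputable def margin {m : ℕ} (P : Fin m → X → X → Prop) (a b : X) : ℤ :=
  ((Finset.univ.filter fun i => P i a b).card : ℤ) -
  ((Finset.univ.filter fun i => P i b a).card : ℤ)


/-- The margins of the counterexample. -/
def cexMargin : List (List ℤ) :=
  [[0, -17, -33, 1, 41, 21, -15],
   [17, 0, -11, -3, -5, 9, -7],
   [33, 11, 0, 39, -35, -23, -19],
   [-1, 3, -39, 0, 37, 25, -27],
   [-41, 5, 35, -37, 0, -13, 29],
   [-21, -9, 23, -25, 13, 0, 31],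
   [15, 7, 19, 27, -29, -31, 0]]

def cexM (p : Fin 7 × Fin 7) : ℤ := (cexMargin.getD p.1.val []).getD p.2.val 0

def cexSucc (p q : Fin 7 × Fin 7) : Prop := cexM q < cexM p

instance cexSuccDec (p q : Fin 7 × Fin 7) : Decidable (cexSucc p q) :=
  inferInstanceAs (Decidable (cexM q < cexM p))

/-- SSV winners of all subsets, indexed by bit masks. -/
def cexTable : List (Fin 7) :=
  [0, 0, 1, 1, 2, 2, 2, 2, 3, 0, 3, 3, 2, 2, 2, 2,
   4, 0, 4, 1, 4, 0, 4, 1, 3, 0, 3, 3, 2, 2, 2, 2,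
   5, 0, 1, 1, 5, 5, 5, 5, 3, 0, 3, 3, 2, 2, 2, 2,
   5, 0, 1, 1, 5, 0, 5, 5, 3, 0, 3, 3, 2, 2, 2, 2,
   6, 6, 6, 6, 6, 6, 6, 6, 6, 6, 6, 6, 6, 6, 6, 6,
   4, 0, 4, 1, 4, 0, 4, 1, 3, 0, 3, 3, 2, 2, 2, 2,
   5, 0, 1, 1, 5, 5, 5, 5, 5, 0, 1, 1, 5, 2, 5, 2,
   5, 0, 1, 1, 5, 0, 5, 5, 3, 0, 3, 3, 5, 0, 5, 0]

def cexW (V : Finset (Fin 7)) : Fin 7 := cexTable.getD (∑ x ∈ V, 2 ^ x.val) 0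

theorem cexW_single : ∀ a : Fin 7, cexW {a} = a := by decide +kernel

theorem cexW_step : ∀ V : Finset (Fin 7), 1 < V.card →
    ∃ b ∈ V, cexW V ∈ V.erase b ∧ cexW (V.erase b) = cexW V ∧
      ∀ d ∈ V, (cexW (V.erase d), d) ≠ (cexW V, b) →
        cexSucc (cexW V, b) (cexW (V.erase d), d) := by decide +kernel

theorem cex_ssv : ∀ (n : ℕ) (V : Finset (Fin 7)) (a : Fin 7), V.card = n + 1 →
    (SSVwinAux cexSucc (n + 1) V a ↔ a = cexW V) := by
  intro n
  induction n with
  | zero =>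
    intro V a hV
    obtain ⟨x, rfl⟩ := Finset.card_eq_one.mp hV
    simp only [SSVwinAux, Finset.card_singleton, lt_irrefl, false_and, or_false, cexW_single,
      Finset.singleton_inj]
    exact eq_comm
  | succ n ih =>
    intro V a hV
    have h1 : 1 < V.card := by omega
    have hc : ∀ d ∈ V, (V.erase d).card = n + 1 := by
      intro d hd
      rw [Finset.card_erase_of_mem hd, hV]; rfl
    obtain ⟨b, hb, hm, hw, hmax⟩ := cexW_step V h1
    rw [SSVwinAux]
    constructor
    · rintro (h | ⟨-, bb, hbb, ha, haw, hamax⟩)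
      · rw [h, cexW_single]
      · by_contra hne
        have e := (ih _ _ (hc bb hbb)).mp haw
        have s1 := hamax (cexW V) b hb hm (fun h => hne (Prod.ext_iff.mp h).1.symm)
          ((ih _ _ (hc b hb)).mpr hw.symm)
        have s2 := hmax bb hbb (fun h => hne (by rw [e]; exact (Prod.ext_iff.mp h).1))
        rw [← e] at s2
        exact lt_asymm s1 s2
    · rintro rfl
      refine Or.inr ⟨h1, b, hb, hm, (ih _ _ (hc b hb)).mpr hw.symm, ?_⟩
      intro c d hd _ hne hcw
      have e := (ih _ _ (hc d hd)).mp hcw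
      subst e
      exact hmax d hd hne

theorem cexM_skew : ∀ a b : Fin 7, cexM (a, b) = - cexM (b, a) := by decide +kernel

theorem cexM_inj : ∀ a b c d : Fin 7, a ≠ b → c ≠ d → (a, b) ≠ (c, d) →
    cexM (a, b) ≠ cexM (c, d) := by decide +kernel

theorem cexM_into : ∀ x : Fin 7, cexSucc (1, 0) (x, 1) := by decide +kernel

/-- There exists a linear ordinal margin matrix with exactly 7 alternatives in
which the SSV winner is not a Split Cycle winner. -/
theorem ssv_not_sc_counterexample_seven :
    ∃ succ : Fin 7 × Fin 7 → Fin 7 × Fin 7 → Prop,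
      IsLinearOMM (Finset.univ : Finset (Fin 7)) succ ∧
      ∃ a, SSVwin Finset.univ succ a ∧ ¬ SCwinner Finset.univ succ a := by
  refine ⟨cexSucc, ⟨⟨Finset.univ_nonempty, ?_, ?_, ?_⟩, ?_⟩, 0, ?_, ?_⟩
  · intro p q _ _ _ _ h
    exact lt_asymm h
  · intro p q r _ _ _ _ _ _ h1 h2
    unfold cexSucc at *
    omega
  · intro a b c d _ _ _ _
    unfold cexSucc
    rw [cexM_skew a b, cexM_skew c d]
    exact neg_lt_neg_iff
  · intro a b c d _ _ _ _ hab hcd h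
    exact (lt_or_gt_of_ne (cexM_inj a b c d hab hcd h)).symm
  · exact (cex_ssv 6 Finset.univ 0 rfl).mpr (by decide +kernel)
  · intro h
    refine h.2 1 (Finset.mem_univ _) ⟨Finset.mem_univ _, Finset.mem_univ _, by decide +kernel, ?_⟩
    rintro ⟨l, -, -, -, hmem, hweak⟩
    have h1 : (1 : Fin 7) ∈ l.rotate 1 := List.mem_rotate.mpr (List.of_mem_zip hmem).1
    obtain ⟨i, hi, hi1⟩ := List.mem_iff_getElem.mp h1
    have hl : i < l.length := by simpa using hi
    have hz : (l[i], (1 : Fin 7)) ∈ l.zip (l.rotate 1) := by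
      rw [← hi1, List.mem_iff_getElem]
      exact ⟨i, by simpa using hl, by simp⟩
    exact hweak _ hz (cexM_into _)
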